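/- Given a block lower triangular array with blocks A_{ij} for 1 ≤ j ≤ i ≤ n (with the (n,1) block X unspecified), there exists a choice of X simultaneously minimizing, for every i ∈ {1,…,n}, the rank of the i-th Hankel block [A_{i1} … A_{ii}; … ; A_{(n-1)1} … A_{(n-1)i}; X A_{n2} … A_{ni}], where X occupies the (n,1) position. -/

import Mathlib

open Matrix

theorem chain_aux {K V W : Type*} [Field K] [AddCommGroup V] [Module K V]
    [AddCommGroup W] [Module K W] (G : ℕ → Submodule K (V × W)) (hG : Monotone G) (k : ℕ) :
    ∃ X : V →ₗ[K] W, ∀ i ≤ k, ∀ v w, (v, w) ∈ G i → (v, X v) ∈ G i := by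
  have single : ∀ S : Submodule K (V × W), ∃ X : V →ₗ[K] W,
      ∀ v w, (v, w) ∈ S → (v, X v) ∈ S := by
    intro S
    let f : S →ₗ[K] V := (LinearMap.fst K V W).comp S.subtype
    obtain ⟨g, hg⟩ := f.rangeRestrict.exists_rightInverse_of_surjective f.range_rangeRestrict
    obtain ⟨X, hX⟩ := (((LinearMap.snd K V W).comp S.subtype).comp g).exists_extend
    refine ⟨X, fun v w h => ?_⟩
    have hv : v ∈ LinearMap.range f := ⟨⟨(v, w), h⟩, rfl⟩
    have h1 := LinearMap.congr_fun hX ⟨v, hv⟩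
    have h2 := congrArg Subtype.val (LinearMap.congr_fun hg ⟨v, hv⟩)
    have h3 : ((g ⟨v, hv⟩ : S) : V × W) = (v, X v) := by
      apply Prod.ext
      · exact h2
      · exact h1.symm
    rw [← h3]
    exact (g ⟨v, hv⟩).2
  induction k with
  | zero =>
    obtain ⟨X, hX⟩ := single (G 0)
    refine ⟨X, fun i hi => ?_⟩
    obtain rfl : i = 0 := by omega
    exact hX
  | succ k ih =>
    obtain ⟨X, hX⟩ := ih
    obtain ⟨Y, hY⟩ := single (G (k+1))
    let D : Submodule K V := (G k).map (LinearMap.fst K V W)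
    obtain ⟨P, hP⟩ := (LinearMap.id : D →ₗ[K] D).exists_extend
    have hPD : ∀ v (hv : v ∈ D), (P v : V) = v := fun v hv =>
      congrArg Subtype.val (LinearMap.congr_fun hP ⟨v, hv⟩)
    refine ⟨X.comp (D.subtype.comp P) + Y.comp (LinearMap.id - D.subtype.comp P), ?_⟩
    intro i hi v w h
    rcases Nat.lt_or_ge k i with h' | h'
    · obtain rfl : i = k + 1 := by omega
      obtain ⟨⟨a, b⟩, hab, hab'⟩ := (P v).2
      have h1 : ((P v : V), X (P v)) ∈ G (k+1) := by
        apply hG (Nat.le_succ k)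
        apply hX k le_rfl _ b
        rw [← hab']
        exact hab
      have h2 := hY (v - P v) (w - X (P v)) ((G (k+1)).sub_mem h h1)
      have h3 := (G (k+1)).add_mem h1 h2
      simpa using h3
    · have hv : v ∈ D := ⟨(v, w), hG h' h, rfl⟩
      have := hPD v hv
      simpa [this] using hX i h' v w h

theorem finrank_sup_aux {K V Z : Type*} [Field K] [AddCommGroup V] [Module K V]
    [AddCommGroup Z] [Module K Z] [FiniteDimensional K V] [FiniteDimensional K Z]
    (f g : V →ₗ[K] Z) (S : Submodule K Z) (h : ∀ v, g v ∈ S → f v ∈ S) :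
    Module.finrank K ↥(LinearMap.range f ⊔ S) ≤ Module.finrank K ↥(LinearMap.range g ⊔ S) := by
  have key : ∀ f : V →ₗ[K] Z, Module.finrank K ↥(LinearMap.range f ⊔ S) +
      Module.finrank K ↥(LinearMap.ker (S.mkQ.comp f)) =
        Module.finrank K V + Module.finrank K S := by
    intro f
    have h1 := (S.mkQ.comp f).finrank_range_add_finrank_ker
    have h2 := (S.mkQ.domRestrict (LinearMap.range f ⊔ S)).finrank_range_add_finrank_ker
    have h3 : LinearMap.range (S.mkQ.domRestrict (LinearMap.range f ⊔ S)) =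
        LinearMap.range (S.mkQ.comp f) := by
      rw [LinearMap.range_domRestrict, Submodule.map_sup, LinearMap.range_comp,
        Submodule.mkQ_map_self, sup_bot_eq]
    have h4 : LinearMap.ker (S.mkQ.domRestrict (LinearMap.range f ⊔ S)) =
        S.comap (LinearMap.range f ⊔ S).subtype := by
      ext x; simp
    have h5 : Module.finrank K ↥(S.comap (LinearMap.range f ⊔ S).subtype) =
        Module.finrank K S :=
      (Submodule.comapSubtypeEquivOfLe (le_sup_right : S ≤ LinearMap.range f ⊔ S)).finrank_eq
    rw [h3, h4, h5] at h2
    omega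
  have hk : LinearMap.ker (S.mkQ.comp g) ≤ LinearMap.ker (S.mkQ.comp f) := by
    intro v hv
    simp only [LinearMap.mem_ker, LinearMap.comp_apply, Submodule.mkQ_apply,
      Submodule.Quotient.mk_eq_zero] at hv ⊢
    exact h v hv
  have := Submodule.finrank_mono hk
  have := key f
  have := key g
  omega

/-- the array with its corner replaced -/
def fillM {K R C : Type*} (rb : R → ℕ) (cb : C → ℕ) (L : ℕ)
    (A X : Matrix R C K) : Matrix R C K :=
  Matrix.of fun r c => if rb r = L ∧ cb c = 0 then X r c else A r c

/-- keep the first block column coordinates -/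
def mask0 (K : Type*) {C : Type*} [Field K] (cb : C → ℕ) : (C → K) →ₗ[K] (C → K) where
  toFun v := fun c => if cb c = 0 then v c else 0
  map_add' u v := by ext c; simp only [Pi.add_apply]; split_ifs <;> simp
  map_smul' a v := by ext c; simp

/-- vectors supported on block columns 1..i -/
def suppS (K : Type*) {C : Type*} [Field K] (cb : C → ℕ) (i : ℕ) : Submodule K (C → K) where
  carrier := {u | ∀ c, (cb c = 0 ∨ i < cb c) → u c = 0}
  add_mem' {u v} hu hv c hc := by simp [hu c hc, hv c hc]
  zero_mem' c hc := rfl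
  smul_mem' a u hu c hc := by simp [hu c hc]

/-- the linear relation -/
def relG {K R C : Type*} [Field K] [Fintype C] (rb : R → ℕ) (cb : C → ℕ) (L : ℕ)
    (A : Matrix R C K) (i : ℕ) : Submodule K ((C → K) × (R → K)) where
  carrier := {x | ∃ u ∈ suppS K cb i, ∀ r, i ≤ rb r →
    (if rb r = L then x.2 r else (A *ᵥ x.1) r) = (A *ᵥ u) r}
  add_mem' := by
    rintro x y ⟨u, hu, h⟩ ⟨v, hv, h'⟩
    refine ⟨u + v, add_mem hu hv, fun r hr => ?_⟩
    rw [Matrix.mulVec_add, Pi.add_apply, ← h r hr, ← h' r hr]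
    split_ifs <;> simp [Matrix.mulVec_add]
  zero_mem' := ⟨0, zero_mem _, fun r hr => by simp⟩
  smul_mem' := by
    rintro a x ⟨u, hu, h⟩
    refine ⟨a • u, Submodule.smul_mem _ _ hu, fun r hr => ?_⟩
    rw [Matrix.mulVec_smul, Pi.smul_apply, ← h r hr]
    split_ifs <;> simp [Matrix.mulVec_smul]

theorem relG_mono {K R C : Type*} [Field K] [Fintype C] (rb : R → ℕ) (cb : C → ℕ) (L : ℕ)
    (A : Matrix R C K) : Monotone (relG rb cb L A) := by
  rintro i j hij x ⟨u, hu, h⟩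
  exact ⟨u, fun c hc => hu c (by omega), fun r hr => h r (by omega)⟩

theorem fill_mulVec_supp {K R C : Type*} [Field K] [Fintype C] (rb : R → ℕ) (cb : C → ℕ) (L : ℕ)
    (A X : Matrix R C K) (i : ℕ) (u : C → K) (hu : u ∈ suppS K cb i) :
    fillM rb cb L A X *ᵥ u = A *ᵥ u := by
  ext r
  simp only [Matrix.mulVec, dotProduct, fillM, Matrix.of_apply]
  refine Finset.sum_congr rfl fun c _ => ?_
  by_cases hc : cb c = 0
  · simp [hu c (Or.inl hc)]
  · simp [hc]

theorem fill_mulVec_mask {K R C : Type*} [Field K] [Fintype C] (rb : R → ℕ) (cb : C → ℕ) (L : ℕ)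
    (A X : Matrix R C K) (v : C → K) (r : R) :
    (fillM rb cb L A X *ᵥ mask0 K cb v) r =
      if rb r = L then (X *ᵥ mask0 K cb v) r else (A *ᵥ mask0 K cb v) r := by
  simp only [Matrix.mulVec, dotProduct, fillM, Matrix.of_apply, mask0, LinearMap.coe_mk,
    AddHom.coe_mk]
  split_ifs with h
  · refine Finset.sum_congr rfl fun c _ => ?_
    by_cases hc : cb c = 0 <;> simp [hc, h]
  · refine Finset.sum_congr rfl fun c _ => ?_
    simp [h]

theorem range_aux {K R C : Type*} [Field K] [Fintype C] (rb : R → ℕ) (cb : C → ℕ)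
    (L : ℕ) (A X : Matrix R C K) (i : ℕ) :
    LinearMap.range ((fillM rb cb L A X).submatrix (fun r : {r // i ≤ rb r} => r.1)
      (fun c : {c // cb c ≤ i} => c.1)).mulVecLin =
    LinearMap.range ((LinearMap.funLeft K K (fun r : {r // i ≤ rb r} => r.1)).comp
      ((fillM rb cb L A X).mulVecLin.comp (mask0 K cb))) ⊔
    (suppS K cb i).map ((LinearMap.funLeft K K (fun r : {r // i ≤ rb r} => r.1)).comp
      A.mulVecLin) := by
  have main : ∀ z : C → K, (∀ c, i < cb c → z c = 0) →
      ((fillM rb cb L A X).submatrix (fun r : {r // i ≤ rb r} => r.1)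
      (fun c : {c // cb c ≤ i} => c.1)) *ᵥ (fun c => z c.1) =
      fun r : {r // i ≤ rb r} => (fillM rb cb L A X *ᵥ z) r.1 := by
    intro z hz
    ext r
    simp only [Matrix.mulVec, dotProduct, Matrix.submatrix_apply]
    rw [← Fintype.sum_subtype_add_sum_subtype (fun c => cb c ≤ i)
      (fun c => fillM rb cb L A X r.1 c * z c)]
    rw [left_eq_add]
    refine Finset.sum_eq_zero fun c _ => ?_
    rw [hz c.1 (not_le.mp c.2), mul_zero]
  apply le_antisymm
  · rintro _ ⟨z, rfl⟩
    let y : C → K := fun c => if h : cb c ≤ i then z ⟨c, h⟩ else 0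
    have hy : ∀ c, i < cb c → y c = 0 := fun c hc => by simp [y, not_le.mpr hc]
    have hz : z = fun c => y c.1 := by ext c; simp [y, c.2]
    have hm : y - mask0 K cb y ∈ suppS K cb i := by
      intro c hc
      rcases hc with hc | hc
      · simp [mask0, hc]
      · simp [mask0, hy c hc]
    rw [Matrix.mulVecLin_apply, hz, main y hy]
    refine Submodule.mem_sup.mpr ⟨_, ⟨y, rfl⟩, _, ⟨_, hm, rfl⟩, ?_⟩
    ext r
    simp only [LinearMap.comp_apply, Pi.add_apply, LinearMap.funLeft_apply,
      Matrix.mulVecLin_apply]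
    rw [← fill_mulVec_supp rb cb L A X i _ hm, ← Pi.add_apply, ← Matrix.mulVec_add]
    simp
  · apply sup_le
    · rintro _ ⟨v, rfl⟩
      refine ⟨fun c => mask0 K cb v c.1, ?_⟩
      rw [Matrix.mulVecLin_apply, main]
      · rfl
      · intro c hc
        have : cb c ≠ 0 := by omega
        simp [mask0, this]
    · rintro _ ⟨u, hu, rfl⟩
      refine ⟨fun c => u c.1, ?_⟩
      rw [Matrix.mulVecLin_apply, main, fill_mulVec_supp rb cb L A X i u hu]
      · rfl
      · intro c hc
        exact hu c (Or.inr hc)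

theorem general_aux {K R C : Type*} [Field K] [Fintype R] [Fintype C] [DecidableEq C]
    (rb : R → ℕ) (cb : C → ℕ) (L : ℕ) (A : Matrix R C K) (k : ℕ) :
    ∃ X : Matrix R C K, ∀ i ≤ k, ∀ Y : Matrix R C K,
      ((fillM rb cb L A X).submatrix (fun r : {r // i ≤ rb r} => r.1)
        (fun c : {c // cb c ≤ i} => c.1)).rank ≤
      ((fillM rb cb L A Y).submatrix (fun r : {r // i ≤ rb r} => r.1)
        (fun c : {c // cb c ≤ i} => c.1)).rank := by
  obtain ⟨X, hX⟩ := chain_aux (relG rb cb L A) (relG_mono rb cb L A) k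
  refine ⟨LinearMap.toMatrix' X, fun i hi Y => ?_⟩
  unfold Matrix.rank
  rw [range_aux, range_aux]
  apply finrank_sup_aux
  rintro v ⟨u, hu, h⟩
  obtain ⟨u', hu', h'⟩ := hX i hi (mask0 K cb v) (Y *ᵥ mask0 K cb v) ⟨u, hu, fun r hr => by
    have := congrFun h ⟨r, hr⟩
    simp only [LinearMap.comp_apply, LinearMap.funLeft_apply, Matrix.mulVecLin_apply,
      fill_mulVec_mask] at this
    exact this.symm⟩
  refine ⟨u', hu', ?_⟩
  ext r
  simp only [LinearMap.comp_apply, LinearMap.funLeft_apply, Matrix.mulVecLin_apply,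
      fill_mulVec_mask, LinearMap.toMatrix'_mulVec]
  exact (h' r.1 r.2).symm

/-- The overlapping block minimal rank completion problem: there is a single choice of
the bottom-left block simultaneously minimizing the ranks of all Hankel blocks.
Block rows are indexed by `(i : Fin n) × Fin (m i)` (block row `i` has `m i` rows) and
block columns by `(j : Fin n) × Fin (p j)`. The data `A` gives all entries of the block
lower triangular array except the `(n,1)` block, whose entries are replaced by those of `X`.
The `i`-th Hankel block consists of block rows `i,…,n` and block columns `1,…,i`. -/
theorem stmt13 (K : Type*) [Field K] (n : ℕ) (hn : 2 ≤ n)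
    (m p : Fin n → ℕ)
    (A : Matrix ((i : Fin n) × Fin (m i)) ((j : Fin n) × Fin (p j)) K) :
    ∃ X : Matrix ((i : Fin n) × Fin (m i)) ((j : Fin n) × Fin (p j)) K,
      ∀ i : Fin n, ∀ Y : Matrix ((i : Fin n) × Fin (m i)) ((j : Fin n) × Fin (p j)) K,
        ((Matrix.of fun r c =>
            if r.1 = (⟨n - 1, by omega⟩ : Fin n) ∧ c.1 = (⟨0, by omega⟩ : Fin n) then
              X r c else A r c).submatrix
          (fun r : {r : (i : Fin n) × Fin (m i) // i ≤ r.1} => r.1)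
          (fun c : {c : (j : Fin n) × Fin (p j) // c.1 ≤ i} => c.1)).rank ≤
        ((Matrix.of fun r c =>
            if r.1 = (⟨n - 1, by omega⟩ : Fin n) ∧ c.1 = (⟨0, by omega⟩ : Fin n) then
              Y r c else A r c).submatrix
          (fun r : {r : (i : Fin n) × Fin (m i) // i ≤ r.1} => r.1)
          (fun c : {c : (j : Fin n) × Fin (p j) // c.1 ≤ i} => c.1)).rank := by
  obtain ⟨X, hX⟩ := general_aux (K := K) (fun r : (i : Fin n) × Fin (m i) => (r.1 : ℕ))
    (fun c : (j : Fin n) × Fin (p j) => (c.1 : ℕ)) (n - 1) A n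
  refine ⟨X, fun i Y => ?_⟩
  have h := hX i i.2.le Y
  simp only [Fin.ext_iff]
  exact h
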